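/- Let n ≥ k be natural numbers, let p ∈ [0,1], let X be an n-element set, let V ⊆ X be nonempty and let L > 0. If g is a function from the k-element subsets of V to [0,1] which is constant on its support, satisfies w(g,p) = 1 and |supp(g)| ≥ (e²/L)^k · binom(|V|, k), then there exists G ⊆ 2^X with ⟨g⟩ ⊆ ⟨G⟩ and w(G, p/L) ≤ 1. -/

import Mathlib

open Finset
open scoped Classical

/-- `w(G,p) = ∑_{T ∈ G} p^{|T|}`. -/
noncomputable def wSet {α : Type*} (G : Finset (Finset α)) (p : ℝ) : ℝ :=
  ∑ T ∈ G, p ^ T.card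

/-- `w(g,p) = ∑_{T ⊆ X} g(T) p^{|T|}`. -/
noncomputable def wFun {α : Type*} (X : Finset α) (g : Finset α → ℝ) (p : ℝ) : ℝ :=
  ∑ T ∈ X.powerset, g T * p ^ T.card

theorem descFactorial_mul_pow_le {t v : ℕ} (h : t ≤ v) (k : ℕ) :
    t.descFactorial k * v ^ k ≤ v.descFactorial k * t ^ k := by
  induction k with
  | zero => simp
  | succ k ih =>
    have h1 : (t - k) * v ≤ (v - k) * t := by
      rw [Nat.sub_mul, Nat.sub_mul, mul_comm t v]
      exact Nat.sub_le_sub_left (Nat.mul_le_mul_left k h) _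
    rw [Nat.descFactorial_succ, Nat.descFactorial_succ, pow_succ, pow_succ]
    calc (t - k) * t.descFactorial k * (v ^ k * v)
        = ((t - k) * v) * (t.descFactorial k * v ^ k) := by ring
      _ ≤ ((v - k) * t) * (v.descFactorial k * t ^ k) := Nat.mul_le_mul h1 ih
      _ = _ := by ring

theorem choose_mul_pow_le {t v : ℕ} (h : t ≤ v) (k : ℕ) :
    t.choose k * v ^ k ≤ v.choose k * t ^ k := by
  have := descFactorial_mul_pow_le h k
  rw [Nat.descFactorial_eq_factorial_mul_choose, Nat.descFactorial_eq_factorial_mul_choose,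
    mul_assoc, mul_assoc] at this
  exact Nat.le_of_mul_le_mul_left this k.factorial_pos

/-- The weight of all `t`-subsets of a `v`-set is at most `1` once `t ≥ e² q v`. -/
theorem choose_mul_pow_le_one {v t : ℕ} {q : ℝ} (hq : 0 ≤ q)
    (h : Real.exp 1 ^ 2 * (q * v) ≤ t) : (v.choose t : ℝ) * q ^ t ≤ 1 := by
  have he : 1 ≤ Real.exp 1 := Real.one_le_exp zero_le_one
  have hqv : 0 ≤ q * v := by positivity
  have h1 : (Real.exp 1 * (q * v)) * Real.exp 1 ≤ t := by linarith
  have h2 : Real.exp 1 * (q * v) ≤ t :=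
    (le_mul_of_one_le_right (by positivity) he).trans h1
  have h3 : Real.exp t = Real.exp 1 ^ t := by
    rw [← Real.exp_nat_mul, mul_one]
  have h4 : (t : ℝ) ^ t / t.factorial ≤ Real.exp 1 ^ t := by
    rw [← h3]
    exact Real.pow_div_factorial_le_exp t t.cast_nonneg t
  have h5 : Real.exp 1 ^ t * ((v.choose t : ℝ) * q ^ t) ≤ Real.exp 1 ^ t * 1 := by
    calc Real.exp 1 ^ t * ((v.choose t : ℝ) * q ^ t)
        ≤ Real.exp 1 ^ t * ((v : ℝ) ^ t / t.factorial * q ^ t) := by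
          gcongr
          exact Nat.choose_le_pow_div t v
      _ = (Real.exp 1 * (q * v)) ^ t / t.factorial := by rw [mul_pow, mul_pow]; ring
      _ ≤ (t : ℝ) ^ t / t.factorial := by gcongr
      _ ≤ Real.exp 1 ^ t * 1 := by rwa [mul_one]
  exact le_of_mul_le_mul_left h5 (by positivity)

theorem sum_powerset_eq_const_mul_card {α : Type*} {g : Finset α → ℝ} {c : ℝ}
    (hc : ∀ T, g T ≠ 0 → g T = c) (S : Finset α) :
    ∑ T ∈ S.powerset, g T = c * ((S.powerset.filter fun T => g T ≠ 0).card : ℝ) := by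
  rw [← Finset.sum_filter_ne_zero, Finset.sum_congr rfl fun T hT => hc T (mem_filter.1 hT).2,
    sum_const, nsmul_eq_mul, mul_comm]

theorem card_support_powerset_le_choose {α : Type*} {g : Finset α → ℝ} {V : Finset α} {k : ℕ}
    (hsupp : ∀ T, g T ≠ 0 → T ⊆ V ∧ T.card = k) (S : Finset α) :
    (S.powerset.filter fun T => g T ≠ 0).card ≤ (S ∩ V).card.choose k := by
  rw [← card_powersetCard]
  refine card_le_card fun T hT => ?_
  rw [mem_filter, mem_powerset] at hT
  rw [mem_powersetCard]
  exact ⟨subset_inter hT.1 (hsupp T hT.2).1, (hsupp T hT.2).2⟩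

theorem wFun_eq_const_mul_card {α : Type*} {g : Finset α → ℝ} {V X : Finset α} {k : ℕ} {c : ℝ}
    (hVX : V ⊆ X) (hsupp : ∀ T, g T ≠ 0 → T ⊆ V ∧ T.card = k)
    (hc : ∀ T, g T ≠ 0 → g T = c) (p : ℝ) :
    wFun X g p = c * ((V.powerset.filter fun T => g T ≠ 0).card : ℝ) * p ^ k := by
  rw [← sum_powerset_eq_const_mul_card hc, sum_mul, wFun]
  symm
  have h : ∀ T, g T * p ^ k = g T * p ^ T.card := fun T => by
    by_cases hT : g T = 0
    · simp [hT]
    · rw [(hsupp T hT).2]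
  rw [sum_congr rfl fun T _ => h T]
  refine sum_subset (powerset_mono.2 hVX) fun T _ hTV => ?_
  have : g T = 0 := by
    by_contra hT
    exact hTV (mem_powerset.2 (hsupp T hT).1)
  simp [this]

/-- Proposition (second part): if `g : (V choose k) → [0,1]` is constant on its support,
satisfies `w(g,p) = 1` and `|supp(g)| ≥ (e²/L)^k · binom(|V|,k)`, then there is
`G ⊆ 2^X` with `⟨g⟩ ⊆ ⟨G⟩` and `w(G, p/L) ≤ 1`. -/
theorem stmt5 {α : Type*} (n k : ℕ) (hk : 0 < k) (hkn : k ≤ n)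
    (p : ℝ) (hp0 : 0 ≤ p) (hp1 : p ≤ 1) (X : Finset α) (hX : X.card = n)
    (V : Finset α) (hVX : V ⊆ X) (hV : V.Nonempty) (L : ℝ) (hL : 0 < L)
    (g : Finset α → ℝ) (hg : ∀ T, 0 ≤ g T ∧ g T ≤ 1)
    (hsupp : ∀ T, g T ≠ 0 → T ⊆ V ∧ T.card = k)
    (hconst : ∃ cst : ℝ, 0 < cst ∧ ∀ T, g T ≠ 0 → g T = cst)
    (hw : wFun X g p = 1)
    (hsize : (Real.exp 1 ^ 2 / L) ^ k * (Nat.choose V.card k : ℝ) ≤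
      ((V.powerset.filter fun T => g T ≠ 0).card : ℝ)) :
    ∃ G : Finset (Finset α), (∀ T ∈ G, T ⊆ X) ∧
      (∀ S ∈ X.powerset, 1 ≤ ∑ T ∈ S.powerset, g T → ∃ T ∈ G, T ⊆ S) ∧
      wSet G (p / L) ≤ 1 := by
  obtain ⟨c, hc0, hc⟩ := hconst
  rw [wFun_eq_const_mul_card hVX hsupp hc] at hw
  set m : ℝ := ((V.powerset.filter fun T => g T ≠ 0).card : ℝ) with hm
  set F := X.powerset.filter fun S => 1 ≤ ∑ T ∈ S.powerset, g T with hF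
  rcases F.eq_empty_or_nonempty with hE | hN
  · refine ⟨∅, by simp, fun S hS h => ?_, by simp [wSet]⟩
    have : S ∈ F := mem_filter.2 ⟨hS, h⟩
    simp [hE] at this
  obtain ⟨S₀, hS₀, hmin⟩ := F.exists_min_image (fun S => (S ∩ V).card) hN
  set t := (S₀ ∩ V).card with ht
  have htv : t ≤ V.card := card_le_card inter_subset_right
  have h1 : 1 ≤ c * (t.choose k : ℝ) := by
    refine (mem_filter.1 hS₀).2.trans ?_
    rw [sum_powerset_eq_const_mul_card hc]
    gcongr
    exact card_support_powerset_le_choose hsupp S₀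
  have hm0 : 0 ≤ m := Nat.cast_nonneg _
  have hmp : m * p ^ k ≤ t.choose k := by
    calc m * p ^ k ≤ m * p ^ k * (c * (t.choose k : ℝ)) :=
          le_mul_of_one_le_right (by positivity) h1
      _ = (c * m * p ^ k) * (t.choose k : ℝ) := by ring
      _ = t.choose k := by rw [hw, one_mul]
  have hkt : k ≤ t := by
    by_contra! h
    rw [Nat.choose_eq_zero_of_lt h] at h1
    norm_num at h1
  have hvk : (0 : ℝ) < V.card.choose k := by exact_mod_cast Nat.choose_pos (hkt.trans htv)
  have hpow : (Real.exp 1 ^ 2 * (p / L * V.card)) ^ k ≤ (t : ℝ) ^ k := by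
    refine le_of_mul_le_mul_left ?_ hvk
    calc (V.card.choose k : ℝ) * (Real.exp 1 ^ 2 * (p / L * V.card)) ^ k
        = ((Real.exp 1 ^ 2 / L) ^ k * V.card.choose k) * p ^ k * (V.card : ℝ) ^ k := by
          rw [show Real.exp 1 ^ 2 * (p / L * V.card) = (Real.exp 1 ^ 2 / L) * p * V.card by ring,
            mul_pow, mul_pow]
          ring
      _ ≤ m * p ^ k * (V.card : ℝ) ^ k := by gcongr
      _ ≤ t.choose k * (V.card : ℝ) ^ k := by gcongr
      _ ≤ V.card.choose k * (t : ℝ) ^ k := by exact_mod_cast choose_mul_pow_le htv k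
  have hle : Real.exp 1 ^ 2 * (p / L * V.card) ≤ t :=
    le_of_pow_le_pow_left₀ hk.ne' (Nat.cast_nonneg _) hpow
  refine ⟨V.powersetCard t, fun T hT => (mem_powersetCard.1 hT).1.trans hVX, fun S hS h => ?_, ?_⟩
  · obtain ⟨T, hT, hTc⟩ := exists_subset_card_eq (hmin S (mem_filter.2 ⟨hS, h⟩))
    exact ⟨T, mem_powersetCard.2 ⟨hT.trans inter_subset_right, hTc⟩, hT.trans inter_subset_left⟩
  · rw [wSet, sum_congr rfl fun T hT => by rw [(mem_powersetCard.1 hT).2], sum_const,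
      card_powersetCard, nsmul_eq_mul]
    exact choose_mul_pow_le_one (by positivity) hle
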